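/- arXiv:1305.1056 — 5 statements merged into one kernel-verified Lean document; each statement's English description precedes it below -/
import Mathlib

section
/- Let θ̂ be any parameter value (in particular the maximum likelihood estimate) at which η and A are twice differentiable and T is integrable with respect to p(·, θ̂)·ν. Then the averaged expected Fisher information equals the averaged observed Fisher information at θ̂, i.e. F̄ₙ(θ̂) = H̄ₙ(θ̂), if and only if η''(θ̂)·( ∫ T(x)·p(x, θ̂) dν(x) − n⁻¹·∑_{i=1}^n T(xᵢ) ) = 0. (Lemma 6 of the paper.) -/
open MeasureTheory Real

/-- The second derivative of an affine combination of `A` and `η`. -/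
theorem deriv_deriv_affine_comb {η A : ℝ → ℝ}
    (hη : Differentiable ℝ η) (hη' : Differentiable ℝ (deriv η))
    (hA : Differentiable ℝ A) (hA' : Differentiable ℝ (deriv A)) (c a t θ : ℝ) :
    deriv (deriv fun θ => c + (a * A θ - t * η θ)) θ =
      a * deriv (deriv A) θ - t * deriv (deriv η) θ := by
  have h1 : (deriv fun θ => c + (a * A θ - t * η θ)) =
      fun θ => a * deriv A θ - t * deriv η θ := by
    funext θ
    exact ((((hA θ).hasDerivAt.const_mul a).sub ((hη θ).hasDerivAt.const_mul t)).const_add c).deriv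
  rw [h1]
  exact (((hA' θ).hasDerivAt.const_mul a).sub ((hη' θ).hasDerivAt.const_mul t)).deriv

/-- Lemma 6: for a one-parameter exponential family `p(x, θ) = h x * exp (η θ * T x - A θ)`,
the averaged expected Fisher information equals the averaged observed Fisher information at a
point `θhat` iff `η''(θhat) * (∫ T x * p(x, θhat) dν - n⁻¹ ∑ T xᵢ) = 0`. -/
theorem stmt_0
    (ν : Measure ℝ) [SigmaFinite ν]
    (h T η A : ℝ → ℝ) (hT : Measurable T)
    (hpos : ∀ x, 0 < h x)
    (hη : Differentiable ℝ η) (hη' : Differentiable ℝ (deriv η))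
    (hA : Differentiable ℝ A) (hA' : Differentiable ℝ (deriv A))
    (p : ℝ → ℝ → ℝ)
    (hp : ∀ x θ, p x θ = h x * Real.exp (η θ * T x - A θ))
    (hnorm : ∀ θ, ∫ x, p x θ ∂ν = 1)
    (n : ℕ) (hn : 1 ≤ n) (xs : Fin n → ℝ)
    (negll : ℝ → ℝ)
    (hnegll : ∀ θ, negll θ = -∑ i, (Real.log (h (xs i)) + η θ * T (xs i) - A θ))
    (Hbar : ℝ → ℝ)
    (hHbar : ∀ θ, Hbar θ = (n : ℝ)⁻¹ * deriv (deriv negll) θ)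
    (θhat : ℝ)
    (hint : Integrable (fun x => T x * p x θhat) ν)
    (Fbar : ℝ)
    (hFbar : Fbar = ∫ x, deriv (deriv (fun θ => -Real.log (p x θ))) θhat * p x θhat ∂ν) :
    Fbar = Hbar θhat ↔
      deriv (deriv η) θhat *
        ((∫ x, T x * p x θhat ∂ν) - (n : ℝ)⁻¹ * ∑ i, T (xs i)) = 0 := by
  have hp_int : Integrable (fun x => p x θhat) ν := by
    by_contra hni
    have h1 := hnorm θhat
    rw [integral_undef hni] at h1
    exact zero_ne_one h1
  have hlog : ∀ x, deriv (deriv fun θ => -Real.log (p x θ)) θhat =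
      deriv (deriv A) θhat - T x * deriv (deriv η) θhat := by
    intro x
    have h1 : (fun θ => -Real.log (p x θ)) =
        fun θ => -Real.log (h x) + (1 * A θ - T x * η θ) := by
      funext θ
      rw [hp, Real.log_mul (hpos x).ne' (Real.exp_ne_zero _), Real.log_exp]
      ring
    rw [h1, deriv_deriv_affine_comb hη hη' hA hA', one_mul]
  have hF : Fbar = deriv (deriv A) θhat - deriv (deriv η) θhat * ∫ x, T x * p x θhat ∂ν := by
    have h1 : (fun x => deriv (deriv fun θ => -Real.log (p x θ)) θhat * p x θhat) =
        fun x => deriv (deriv A) θhat * p x θhat -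
          deriv (deriv η) θhat * (T x * p x θhat) := by
      funext x
      rw [hlog]
      ring
    rw [hFbar, h1, integral_sub (hp_int.const_mul _) (hint.const_mul _), integral_const_mul,
      integral_const_mul, hnorm, mul_one]
  have hn0 : (n : ℝ) ≠ 0 := by positivity
  have hH : Hbar θhat = deriv (deriv A) θhat -
      deriv (deriv η) θhat * ((n : ℝ)⁻¹ * ∑ i, T (xs i)) := by
    have h1 : negll = fun θ => -(∑ i, Real.log (h (xs i))) +
        ((n : ℝ) * A θ - (∑ i, T (xs i)) * η θ) := by
      funext θ
      rw [hnegll, Finset.sum_sub_distrib, Finset.sum_add_distrib, ← Finset.mul_sum,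
        Finset.sum_const, Finset.card_univ, Fintype.card_fin, nsmul_eq_mul]
      ring
    rw [hHbar, h1, deriv_deriv_affine_comb hη hη' hA hA']
    field_simp
  rw [hF, hH]
  constructor <;> intro h1 <;> linarith
end

section
/- Suppose the coordinates Δ₁, …, Δ_p of the perturbation vector are i.i.d. with common law μ on ℝ satisfying μ({0}) = 0, where the functions x, x², 1/x, 1/x² are all μ-integrable with ∫ x dμ(x) = 0, ∫ x² dμ(x) = v, and ∫ x⁻² dμ(x) = m; suppose ε⁺, ε⁻ are square-integrable with mean 0 and variance σ² each, and Δ, ε⁺, ε⁻ are mutually independent. Then the one-step SPSA mean squared error for the quadratic loss is exactly E‖θ̂₁ − θ*‖² = ‖θ₀ − θ*‖² − 2a·⟨θ₀ − θ*, g⟩ + a²·( (1 + v·m·(p − 1))·‖g‖² + p·m·σ²/(2c²) ). (The exact one-iteration MSE formula underlying display (A.8) for quadratic losses.) -/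
open MeasureTheory Real Matrix

/-- The central difference of a quadratic loss is exactly its directional derivative. -/
lemma quadratic_central_difference {n : Type*} [Fintype n] {Q : Matrix n n ℝ} (hQ : Q.IsSymm)
    (b x d : n → ℝ) :
    ((1 / 2) * ((x + d) ⬝ᵥ Q.mulVec (x + d)) + b ⬝ᵥ (x + d)) -
      ((1 / 2) * ((x - d) ⬝ᵥ Q.mulVec (x - d)) + b ⬝ᵥ (x - d)) =
      2 * ((Q.mulVec x + b) ⬝ᵥ d) := by
  have hsymm : x ⬝ᵥ Q.mulVec d = d ⬝ᵥ Q.mulVec x := by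
    rw [dotProduct_mulVec, ← mulVec_transpose, hQ.eq, dotProduct_comm]
  have hcomm : Q.mulVec x ⬝ᵥ d = d ⬝ᵥ Q.mulVec x := dotProduct_comm _ _
  simp only [mulVec_add, mulVec_sub, add_dotProduct, sub_dotProduct, dotProduct_add,
    dotProduct_sub, hsymm, hcomm]
  ring

section Moments

variable {n : Type*} [Fintype n] [DecidableEq n] {μ : Measure ℝ} [IsProbabilityMeasure μ]

lemma integral_inv_coord_mul_coord (hμ0 : μ {0} = 0) (hmean : ∫ x, x ∂μ = 0) (i j : n) :
    ∫ x : n → ℝ, x j * (x i)⁻¹ ∂Measure.pi (fun _ => μ) = if j = i then 1 else 0 := by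
  have hne : ∀ᵐ x ∂μ, x ≠ 0 := by
    rw [ae_iff]; simpa using hμ0
  have hprod : ∀ x : n → ℝ, x j * (x i)⁻¹ =
      ∏ l, (if l = j then x l else 1) * (if l = i then (x l)⁻¹ else 1) := by
    intro x; simp only [Finset.prod_mul_distrib, Finset.prod_ite_eq', Finset.mem_univ, if_true]
  simp_rw [hprod]
  rw [integral_fintype_prod_eq_prod (𝕜 := ℝ) (μ := fun _ : n => μ)
    (fun l t => (if l = j then t else 1) * (if l = i then t⁻¹ else 1))]
  split_ifs with h
  · subst h
    refine Finset.prod_eq_one fun l _ => ?_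
    by_cases hl : l = j
    · have : (fun t : ℝ => t * t⁻¹) =ᵐ[μ] fun _ => 1 := by
        filter_upwards [hne] with t ht using mul_inv_cancel₀ ht
      simp [hl, integral_congr_ae this]
    · simp [hl]
  · exact Finset.prod_eq_zero (Finset.mem_univ j) (by simp [h, hmean])

lemma coord_mul_coord_mul_inv_sq_eq_prod (i j k : n) (x : n → ℝ) :
    x j * x k * ((x i) ^ 2)⁻¹ = ∏ l, (if l = j then x l else 1) * (if l = k then x l else 1) *
      (if l = i then ((x l) ^ 2)⁻¹ else 1) := by
  simp only [Finset.prod_mul_distrib, Finset.prod_ite_eq', Finset.mem_univ, if_true]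

lemma integrable_coord_mul_coord_mul_inv_sq (hμ0 : μ {0} = 0)
    (hi1 : Integrable (fun x => x) μ) (hi2 : Integrable (fun x => x ^ 2) μ)
    (hi3 : Integrable (fun x => x⁻¹) μ) (hi4 : Integrable (fun x => (x ^ 2)⁻¹) μ) (i j k : n) :
    Integrable (fun x : n → ℝ => x j * x k * ((x i) ^ 2)⁻¹) (Measure.pi fun _ => μ) := by
  have hne : ∀ᵐ x ∂μ, x ≠ 0 := by
    rw [ae_iff]; simpa using hμ0
  have h1 : Integrable (fun t : ℝ => t * (t ^ 2)⁻¹) μ := by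
    refine hi3.congr ?_
    filter_upwards [hne] with t ht
    field_simp
  have h2 : Integrable (fun t : ℝ => t * t * (t ^ 2)⁻¹) μ := by
    refine (integrable_const (1 : ℝ)).congr ?_
    filter_upwards [hne] with t ht
    field_simp
  have h3 : Integrable (fun t : ℝ => t * t) μ := by simpa only [sq] using hi2
  simp_rw [coord_mul_coord_mul_inv_sq_eq_prod]
  refine Integrable.fintype_prod (μ := fun _ : n => μ)
    (f := fun l t => (if l = j then t else 1) * (if l = k then t else 1) *
      (if l = i then (t ^ 2)⁻¹ else 1)) fun l => ?_
  split_ifs <;> (try simp only [one_mul, mul_one]) <;>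
    first | assumption | exact integrable_const _

lemma integral_coord_mul_coord_mul_inv_sq (hμ0 : μ {0} = 0) {v m : ℝ}
    (hmean : ∫ x, x ∂μ = 0) (hv : ∫ x, x ^ 2 ∂μ = v) (hm : ∫ x, (x ^ 2)⁻¹ ∂μ = m) (i j k : n) :
    ∫ x : n → ℝ, x j * x k * ((x i) ^ 2)⁻¹ ∂Measure.pi (fun _ => μ) =
      if j = k then (if j = i then 1 else v * m) else 0 := by
  have hne : ∀ᵐ x ∂μ, x ≠ 0 := by
    rw [ae_iff]; simpa using hμ0
  simp_rw [coord_mul_coord_mul_inv_sq_eq_prod]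
  rw [integral_fintype_prod_eq_prod (𝕜 := ℝ) (μ := fun _ : n => μ)
    (fun l t => (if l = j then t else 1) * (if l = k then t else 1) *
      (if l = i then (t ^ 2)⁻¹ else 1))]
  split_ifs with hjk hji
  · subst hjk hji
    refine Finset.prod_eq_one fun l _ => ?_
    by_cases hl : l = j
    · have : (fun t : ℝ => t * t * (t ^ 2)⁻¹) =ᵐ[μ] fun _ => 1 := by
        filter_upwards [hne] with t ht
        field_simp
      simp [hl, integral_congr_ae this]
    · simp [hl]
  · subst hjk
    have hfactor : ∀ l, ∫ t, (if l = j then t else 1) * (if l = j then t else 1) *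
        (if l = i then (t ^ 2)⁻¹ else 1) ∂μ =
        (if l = j then v else 1) * (if l = i then m else 1) := by
      intro l
      by_cases hl : l = j
      · subst hl; simp [hji, ← sq, hv]
      · by_cases hl' : l = i
        · subst hl'; simpa [hl] using hm
        · simp [hl, hl']
    simp_rw [hfactor]
    simp only [Finset.prod_mul_distrib, Finset.prod_ite_eq', Finset.mem_univ, if_true]
  · by_cases hji : j = i
    · refine Finset.prod_eq_zero (Finset.mem_univ k) ?_
      have hki : k ≠ i := fun h => hjk (hji.trans h.symm)
      simp [Ne.symm hjk, hki, hmean]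
    · exact Finset.prod_eq_zero (Finset.mem_univ j) (by simp [hjk, hji, hmean])

end Moments

section Noise

variable {νp νm : Measure ℝ} [IsProbabilityMeasure νp] [IsProbabilityMeasure νm]

lemma integrable_sub_prod (hp : Integrable (fun x => x) νp) (hm : Integrable (fun x => x) νm) :
    Integrable (fun e : ℝ × ℝ => e.1 - e.2) (νp.prod νm) :=
  (hp.comp_fst νm).sub (hm.comp_snd νp)

lemma integral_sub_prod (hp : Integrable (fun x => x) νp) (hm : Integrable (fun x => x) νm) :
    ∫ e : ℝ × ℝ, e.1 - e.2 ∂νp.prod νm = ∫ x, x ∂νp - ∫ x, x ∂νm := by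
  rw [integral_sub (hp.comp_fst νm) (hm.comp_snd νp),
    integral_fun_fst (fun x : ℝ => x), integral_fun_snd (fun x : ℝ => x)]
  simp

lemma integrable_sub_sq_prod (hp : Integrable (fun x => x) νp) (hm : Integrable (fun x => x) νm)
    (hp2 : Integrable (fun x => x ^ 2) νp) (hm2 : Integrable (fun x => x ^ 2) νm) :
    Integrable (fun e : ℝ × ℝ => (e.1 - e.2) ^ 2) (νp.prod νm) := by
  refine (((hp2.comp_fst νm).add (hm2.comp_snd νp)).sub ((hp.mul_prod hm).const_mul 2)).congr
    (.of_forall fun e => ?_)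
  simp only [Pi.add_apply, Pi.sub_apply]
  ring

lemma integral_sub_sq_prod (hp : Integrable (fun x => x) νp) (hm : Integrable (fun x => x) νm)
    (hp2 : Integrable (fun x => x ^ 2) νp) (hm2 : Integrable (fun x => x ^ 2) νm) :
    ∫ e : ℝ × ℝ, (e.1 - e.2) ^ 2 ∂νp.prod νm =
      ∫ x, x ^ 2 ∂νp + ∫ x, x ^ 2 ∂νm - 2 * ((∫ x, x ∂νp) * ∫ x, x ∂νm) := by
  have hexpand : ∀ e : ℝ × ℝ, (e.1 - e.2) ^ 2 = e.1 ^ 2 + e.2 ^ 2 - 2 * (e.1 * e.2) :=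
    fun e => by ring
  have hadd : Integrable (fun e : ℝ × ℝ => e.1 ^ 2 + e.2 ^ 2) (νp.prod νm) :=
    (hp2.comp_fst νm).add (hm2.comp_snd νp)
  simp_rw [hexpand]
  rw [integral_sub hadd ((hp.mul_prod hm).const_mul 2),
    integral_add (hp2.comp_fst νm) (hm2.comp_snd νp), integral_const_mul,
    integral_prod_mul (fun x : ℝ => x) (fun x : ℝ => x),
    integral_fun_fst (fun x : ℝ => x ^ 2), integral_fun_snd (fun x : ℝ => x ^ 2)]
  simp

end Noise

/-- Mean of a quadratic polynomial in a centred noise independent of its coefficients. -/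
lemma integral_quadratic_in_noise {X Y : Type*} [MeasurableSpace X] [MeasurableSpace Y]
    {ρ : Measure X} {ν : Measure Y} [SFinite ρ] [IsProbabilityMeasure ν]
    {A B C : X → ℝ} {η : Y → ℝ} (hA : Integrable A ρ) (hB : Integrable B ρ) (hC : Integrable C ρ)
    (hη : Integrable η ν) (hη2 : Integrable (fun y => η y ^ 2) ν) (hmean : ∫ y, η y ∂ν = 0) :
    ∫ z, (A z.1 + B z.1 * η z.2 + C z.1 * η z.2 ^ 2) ∂ρ.prod ν =
      ∫ x, A x ∂ρ + (∫ x, C x ∂ρ) * ∫ y, η y ^ 2 ∂ν := by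
  have hadd : Integrable (fun z : X × Y => A z.1 + B z.1 * η z.2) (ρ.prod ν) :=
    (hA.comp_fst ν).add (hB.mul_prod hη)
  rw [integral_add hadd (hC.mul_prod hη2),
    integral_add (hA.comp_fst ν) (hB.mul_prod hη), integral_prod_mul B η,
    integral_prod_mul C (fun y => η y ^ 2), integral_fun_fst A, hmean]
  simp

/-- Exact one-iteration SPSA mean squared error for a quadratic loss
`L(θ) = (1/2)θᵀQθ + bᵀθ`: with i.i.d. perturbation coordinates of law `μ`
(mean 0, second moment `v`, inverse second moment `m`) and independent mean-zero
noises of variance `σ²`,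
`E‖θ̂₁ − θ*‖² = ‖θ₀ − θ*‖² − 2a⟨θ₀ − θ*, g⟩ + a²((1 + v m (p−1))‖g‖² + p m σ²/(2c²))`. -/
theorem stmt_7
    (p : ℕ) (hp : 1 ≤ p)
    (Q : Matrix (Fin p) (Fin p) ℝ) (hQ : Q.IsSymm) (b : Fin p → ℝ)
    (θ₀ θs : Fin p → ℝ) (a c : ℝ) (ha : 0 < a) (hc : 0 < c)
    (L : (Fin p → ℝ) → ℝ)
    (hL : ∀ θ, L θ = (1 / 2) * (θ ⬝ᵥ Q.mulVec θ) + b ⬝ᵥ θ)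
    (g : Fin p → ℝ) (hg : g = Q.mulVec θ₀ + b)
    (μ : Measure ℝ) [IsProbabilityMeasure μ]
    (hμ0 : μ {0} = 0)
    (hi1 : Integrable (fun x => x) μ) (hi2 : Integrable (fun x => x ^ 2) μ)
    (hi3 : Integrable (fun x => x⁻¹) μ) (hi4 : Integrable (fun x => (x ^ 2)⁻¹) μ)
    (v m : ℝ)
    (hmean : ∫ x, x ∂μ = 0) (hv : ∫ x, x ^ 2 ∂μ = v) (hm : ∫ x, (x ^ 2)⁻¹ ∂μ = m)
    (νp νm : Measure ℝ) [IsProbabilityMeasure νp] [IsProbabilityMeasure νm]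
    (σ : ℝ)
    (hνp1 : Integrable (fun x => x) νp) (hνp2 : Integrable (fun x => x ^ 2) νp)
    (hνm1 : Integrable (fun x => x) νm) (hνm2 : Integrable (fun x => x ^ 2) νm)
    (hνpmean : ∫ x, x ∂νp = 0) (hνmmean : ∫ x, x ∂νm = 0)
    (hνpvar : ∫ x, x ^ 2 ∂νp = σ ^ 2) (hνmvar : ∫ x, x ^ 2 ∂νm = σ ^ 2)
    (P : Measure ((Fin p → ℝ) × ℝ × ℝ))
    (hP : P = (Measure.pi fun _ : Fin p => μ).prod (νp.prod νm))
    (θ1 : ((Fin p → ℝ) × ℝ × ℝ) → Fin p → ℝ)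
    (hθ1 : ∀ ω i, θ1 ω i = θ₀ i -
      a / (2 * c) * (L (θ₀ + c • ω.1) - L (θ₀ - c • ω.1) + ω.2.1 - ω.2.2) * (ω.1 i)⁻¹) :
    ∫ ω, ∑ i, (θ1 ω i - θs i) ^ 2 ∂P
      = ∑ i, (θ₀ i - θs i) ^ 2
        - 2 * a * ∑ i, (θ₀ i - θs i) * g i
        + a ^ 2 * ((1 + v * m * ((p : ℝ) - 1)) * ∑ i, g i ^ 2
            + (p : ℝ) * m * σ ^ 2 / (2 * c ^ 2)) := by
  have hstep : ∀ ω : (Fin p → ℝ) × ℝ × ℝ, ∀ i, θ1 ω i - θs i =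
      (θ₀ i - θs i - a * ((g ⬝ᵥ ω.1) * (ω.1 i)⁻¹)) -
        a / (2 * c) * (ω.1 i)⁻¹ * (ω.2.1 - ω.2.2) := by
    intro ω i
    have hdiff := quadratic_central_difference hQ b θ₀ (c • ω.1)
    rw [← hL, ← hL, ← hg, dotProduct_smul, smul_eq_mul] at hdiff
    rw [hθ1, hdiff]
    field_simp
    ring
  set ρ : Measure (Fin p → ℝ) := Measure.pi fun _ => μ with hρ
  set d : Fin p → ℝ := fun i => θ₀ i - θs i with hd
  have hmoment : ∀ i j k, Integrable (fun x : Fin p → ℝ => x j * x k * ((x i) ^ 2)⁻¹) ρ :=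
    integrable_coord_mul_coord_mul_inv_sq hμ0 hi1 hi2 hi3 hi4
  have hinv_sq : ∀ i, Integrable (fun x : Fin p → ℝ => ((x i) ^ 2)⁻¹) ρ := fun i =>
    integrable_comp_eval (μ := fun _ : Fin p => μ) (i := i) hi4
  have hinv_mem : ∀ i, MemLp (fun x : Fin p → ℝ => (x i)⁻¹) 2 ρ := fun i => by
    refine (memLp_two_iff_integrable_sq
      (measurable_pi_apply i).inv.aestronglyMeasurable).2 ?_
    simpa only [inv_pow] using hinv_sq i
  have hratio_mem : ∀ i j, MemLp (fun x : Fin p → ℝ => x j * (x i)⁻¹) 2 ρ := fun i j => by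
    refine (memLp_two_iff_integrable_sq ((measurable_pi_apply j).mul
      (measurable_pi_apply i).inv).aestronglyMeasurable).2 ((hmoment i j j).congr ?_)
    exact .of_forall fun x => by simp only [mul_pow, inv_pow]; ring
  have hslope_eq : ∀ i, (fun x : Fin p → ℝ => (g ⬝ᵥ x) * (x i)⁻¹) =
      fun x => ∑ j, g j * (x j * (x i)⁻¹) := fun i => by
    funext x
    simp only [dotProduct, Finset.sum_mul, mul_assoc]
  have hslope_mem : ∀ i, MemLp (fun x : Fin p → ℝ => (g ⬝ᵥ x) * (x i)⁻¹) 2 ρ := fun i => by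
    rw [hslope_eq]
    exact memLp_finsetSum _ fun j _ => (hratio_mem i j).const_mul (g j)
  have hslope_int : ∀ i, ∫ x, (g ⬝ᵥ x) * (x i)⁻¹ ∂ρ = g i := fun i => by
    rw [hslope_eq, integral_finsetSum _ fun j _ =>
      ((hratio_mem i j).integrable (by norm_num)).const_mul (g j)]
    simp_rw [integral_const_mul, hρ, integral_inv_coord_mul_coord hμ0 hmean]
    simp
  have hslope_sq : ∀ i, ∫ x, ((g ⬝ᵥ x) * (x i)⁻¹) ^ 2 ∂ρ =
      g i ^ 2 + v * m * (∑ j, g j ^ 2 - g i ^ 2) := fun i => by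
    have hexpand : ∀ x : Fin p → ℝ, ((g ⬝ᵥ x) * (x i)⁻¹) ^ 2 =
        ∑ j, ∑ k, g j * g k * (x j * x k * ((x i) ^ 2)⁻¹) := fun x => by
      rw [mul_pow, inv_pow, sq (g ⬝ᵥ x), dotProduct, Finset.sum_mul_sum, Finset.sum_mul]
      refine Finset.sum_congr rfl fun j _ => ?_
      rw [Finset.sum_mul]
      exact Finset.sum_congr rfl fun k _ => by ring
    simp_rw [hexpand]
    rw [integral_finsetSum _ fun j _ => integrable_finsetSum _ fun k _ =>
      (hmoment i j k).const_mul _]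
    have hinner : ∀ j, ∫ x, ∑ k, g j * g k * (x j * x k * ((x i) ^ 2)⁻¹) ∂ρ =
        v * m * g j ^ 2 + if j = i then g j ^ 2 * (1 - v * m) else 0 := fun j => by
      rw [integral_finsetSum _ fun k _ => (hmoment i j k).const_mul _]
      simp_rw [integral_const_mul, hρ, integral_coord_mul_coord_mul_inv_sq hμ0 hmean hv hm]
      simp only [mul_ite, mul_zero, Finset.sum_ite_eq, Finset.mem_univ, if_true]
      split_ifs <;> ring
    simp_rw [hinner, Finset.sum_add_distrib, ← Finset.mul_sum]
    simp only [Finset.sum_ite_eq', Finset.mem_univ, if_true]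
    ring
  have hdev_mem : ∀ i, MemLp (fun x : Fin p → ℝ => d i - a * ((g ⬝ᵥ x) * (x i)⁻¹)) 2 ρ :=
    fun i => (memLp_const (d i)).sub ((hslope_mem i).const_mul a)
  have hdev_sq : ∀ i, ∫ x, (d i - a * ((g ⬝ᵥ x) * (x i)⁻¹)) ^ 2 ∂ρ =
      d i ^ 2 - 2 * a * (d i * g i) + a ^ 2 * (g i ^ 2 + v * m * (∑ j, g j ^ 2 - g i ^ 2)) :=
    fun i => by
      have hexpand : ∀ x : Fin p → ℝ, (d i - a * ((g ⬝ᵥ x) * (x i)⁻¹)) ^ 2 =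
          d i ^ 2 - 2 * a * d i * ((g ⬝ᵥ x) * (x i)⁻¹) + a ^ 2 * ((g ⬝ᵥ x) * (x i)⁻¹) ^ 2 :=
        fun x => by ring
      have hlin := ((hslope_mem i).integrable (by norm_num)).const_mul (2 * a * d i)
      have hsub : Integrable (fun x : Fin p → ℝ =>
          d i ^ 2 - 2 * a * d i * ((g ⬝ᵥ x) * (x i)⁻¹)) ρ := (integrable_const _).sub hlin
      simp_rw [hexpand]
      rw [integral_add hsub ((hslope_mem i).integrable_sq.const_mul _),
        integral_sub (integrable_const _) hlin, integral_const_mul, integral_const_mul,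
        hslope_int, hslope_sq]
      simp [mul_assoc]
  have hintegrand : ∀ ω : (Fin p → ℝ) × ℝ × ℝ, ∑ i, (θ1 ω i - θs i) ^ 2 =
      (∑ i, (d i - a * ((g ⬝ᵥ ω.1) * (ω.1 i)⁻¹)) ^ 2) +
      (∑ i, -(a / c) * ((d i - a * ((g ⬝ᵥ ω.1) * (ω.1 i)⁻¹)) * (ω.1 i)⁻¹)) * (ω.2.1 - ω.2.2) +
      (∑ i, (a / (2 * c)) ^ 2 * ((ω.1 i) ^ 2)⁻¹) * (ω.2.1 - ω.2.2) ^ 2 := fun ω => by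
    simp_rw [hstep]
    rw [Finset.sum_mul, Finset.sum_mul, ← Finset.sum_add_distrib, ← Finset.sum_add_distrib]
    refine Finset.sum_congr rfl fun i _ => ?_
    rw [← inv_pow]
    ring
  simp_rw [hintegrand]
  rw [hP, integral_quadratic_in_noise (η := fun e : ℝ × ℝ => e.1 - e.2)
    (A := fun x => ∑ i, (d i - a * ((g ⬝ᵥ x) * (x i)⁻¹)) ^ 2)
    (B := fun x => ∑ i, -(a / c) * ((d i - a * ((g ⬝ᵥ x) * (x i)⁻¹)) * (x i)⁻¹))
    (C := fun x => ∑ i, (a / (2 * c)) ^ 2 * ((x i) ^ 2)⁻¹)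
    (integrable_finsetSum _ fun i _ => (hdev_mem i).integrable_sq)
    (integrable_finsetSum _ fun i _ => ((hdev_mem i).integrable_mul (hinv_mem i)).const_mul _)
    (integrable_finsetSum _ fun i _ => (hinv_sq i).const_mul _)
    (integrable_sub_prod hνp1 hνm1) (integrable_sub_sq_prod hνp1 hνm1 hνp2 hνm2)
    (by rw [integral_sub_prod hνp1 hνm1, hνpmean, hνmmean, sub_zero]),
    integral_sub_sq_prod hνp1 hνm1 hνp2 hνm2, hνpvar, hνmvar, hνpmean, hνmmean,
    integral_finsetSum _ fun i _ => (hdev_mem i).integrable_sq,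
    integral_finsetSum _ fun i _ => (hinv_sq i).const_mul _]
  have hinv_int : ∀ i, ∫ x : Fin p → ℝ, ((x i) ^ 2)⁻¹ ∂ρ = m := fun i => by
    rw [hρ, integral_comp_eval (μ := fun _ : Fin p => μ) (i := i) hi4.aestronglyMeasurable, hm]
  simp_rw [integral_const_mul, hinv_int, hdev_sq]
  simp only [Finset.sum_add_distrib, Finset.sum_sub_distrib, ← Finset.mul_sum, Finset.sum_const,
    Finset.card_univ, Fintype.card_fin, nsmul_eq_mul]
  field_simp
  ring
end

section
/- Let p = 2 and write g = (L₁, L₂) and θ₀ − θ* = (θ₀₁ − θ₁*, θ₀₂ − θ₂*). With the same two experiments as in Corollary A.2 (Δ coordinates i.i.d. segmented uniform with gains a_S, c_S versus i.i.d. Bernoulli ±1 with gains a_B, c_B; noises square-integrable, mean 0, variance σ², mutually independent of Δ), if ( (161/61)·a_S² − 2·a_B² )·(L₁² + L₂²) + (a_S − a_B)·( σ²·(a_S + a_B)/c_B² − 2·(L₁·(θ₀₁ − θ₁*) + L₂·(θ₀₂ − θ₂*)) ) − a_S²·σ²·( 1/c_B² − 100/(61·c_S²) ) < 0, then E_S‖θ̂₁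 − θ*‖² < E_B‖θ̂₁ − θ*‖². (Corollary A.3, display (A.11).) -/
open MeasureTheory Real Matrix

/-- The support of the segmented uniform distribution. -/
noncomputable def suSet : Set ℝ :=
  Set.Ioo (-((19 + 3 * Real.sqrt 13) / 20)) (-((19 - 3 * Real.sqrt 13) / 20)) ∪
    Set.Ioo ((19 - 3 * Real.sqrt 13) / 20) ((19 + 3 * Real.sqrt 13) / 20)

/-- The segmented uniform distribution: normalized Lebesgue measure on `suSet`. -/
noncomputable def suMeasure : Measure ℝ := (volume suSet)⁻¹ • volume.restrict suSet

/-- The Bernoulli ±1 distribution `(1/2)(δ₋₁ + δ₁)`. -/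
noncomputable def bernoulliPM : Measure ℝ :=
  (2⁻¹ : ENNReal) • (Measure.dirac (-1) + Measure.dirac 1)

/-- `F` is integrable with integral `v`. -/
def HasIntegralValue {α : Type*} [MeasurableSpace α] (μ : Measure α) (F : α → ℝ) (v : ℝ) : Prop :=
  Integrable F μ ∧ ∫ x, F x ∂μ = v

namespace HasIntegralValue

variable {α : Type*} [MeasurableSpace α] {μ : Measure α} {F G : α → ℝ} {v w : ℝ}

lemma add (hF : HasIntegralValue μ F v) (hG : HasIntegralValue μ G w) :
    HasIntegralValue μ (fun x => F x + G x) (v + w) :=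
  ⟨hF.1.add hG.1, by rw [integral_add hF.1 hG.1, hF.2, hG.2]⟩

lemma const_mul (c : ℝ) (hF : HasIntegralValue μ F v) :
    HasIntegralValue μ (fun x => c * F x) (c * v) :=
  ⟨hF.1.const_mul c, by rw [integral_const_mul, hF.2]⟩

lemma one [IsProbabilityMeasure μ] : HasIntegralValue μ (fun _ => (1 : ℝ)) 1 :=
  ⟨integrable_const _, by simp⟩

lemma congr_value (hF : HasIntegralValue μ F v) (h : v = w) : HasIntegralValue μ F w :=
  h ▸ hF

lemma congr_ae (hF : HasIntegralValue μ F v) (h : G =ᵐ[μ] F) : HasIntegralValue μ G v :=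
  ⟨hF.1.congr h.symm, by rw [integral_congr_ae h, hF.2]⟩

lemma mul_prod {β : Type*} [MeasurableSpace β] {ν : Measure β} [SFinite μ] [SFinite ν]
    {H : β → ℝ} (hF : HasIntegralValue μ F v) (hH : HasIntegralValue ν H w) :
    HasIntegralValue (μ.prod ν) (fun z => F z.1 * H z.2) (v * w) :=
  ⟨hF.1.mul_prod hH.1, by rw [integral_prod_mul, hF.2, hH.2]⟩

lemma mul_pi_two {μ : Measure ℝ} [SigmaFinite μ] {F G : ℝ → ℝ}
    (hF : HasIntegralValue μ F v) (hG : HasIntegralValue μ G w) :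
    HasIntegralValue (Measure.pi fun _ : Fin 2 => μ) (fun x => F (x 0) * G (x 1)) (v * w) := by
  have hint : ∀ i : Fin 2, Integrable ((![F, G] : Fin 2 → ℝ → ℝ) i) μ := by
    intro i
    fin_cases i
    · exact hF.1
    · exact hG.1
  refine ⟨?_, ?_⟩
  · simpa [Fin.prod_univ_two] using Integrable.fintype_prod (μ := fun _ => μ) hint
  · have h := integral_fintype_prod_eq_prod (μ := fun _ : Fin 2 => μ) (![F, G] : Fin 2 → ℝ → ℝ)
    simpa [Fin.prod_univ_two, hF.2, hG.2] using h

end HasIntegralValue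

/-- The mean zero and second moment of a difference of independent centred noises. -/
lemma hasIntegralValue_noise_sub {νp νm : Measure ℝ} [IsProbabilityMeasure νp]
    [IsProbabilityMeasure νm] {s : ℝ}
    (hp1 : HasIntegralValue νp (fun x => x) 0) (hp2 : HasIntegralValue νp (fun x => x ^ 2) s)
    (hm1 : HasIntegralValue νm (fun x => x) 0) (hm2 : HasIntegralValue νm (fun x => x ^ 2) s) :
    HasIntegralValue (νp.prod νm) (fun z => z.1 - z.2) 0 ∧
      HasIntegralValue (νp.prod νm) (fun z => (z.1 - z.2) ^ 2) (2 * s) := by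
  have a := hp1.mul_prod (HasIntegralValue.one (μ := νm))
  have b := (HasIntegralValue.one (μ := νp)).mul_prod hm1
  have c := hp2.mul_prod (HasIntegralValue.one (μ := νm))
  have d := (HasIntegralValue.one (μ := νp)).mul_prod hm2
  have e := hp1.mul_prod hm1
  constructor
  · convert a.add (b.const_mul (-1)) using 1
    · ext z; ring
    · ring
  · convert (c.add d).add (e.const_mul (-2)) using 1
    · ext z; ring
    · ring

/-- The symmetric difference quotient of a quadratic form is exact. -/
lemma quadratic_central_difference_s9 (Q : Matrix (Fin 2) (Fin 2) ℝ) (hQ : Q.IsSymm)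
    (b θ₀ : Fin 2 → ℝ) (L : (Fin 2 → ℝ) → ℝ)
    (hL : ∀ θ, L θ = (1 / 2) * (θ ⬝ᵥ Q.mulVec θ) + b ⬝ᵥ θ)
    (g : Fin 2 → ℝ) (hg : g = Q.mulVec θ₀ + b) (c : ℝ) (x : Fin 2 → ℝ) :
    L (θ₀ + c • x) - L (θ₀ - c • x) = 2 * c * (g 0 * x 0 + g 1 * x 1) := by
  have h : Q 1 0 = Q 0 1 := hQ.apply 0 1
  simp only [hL, hg, Matrix.mulVec, dotProduct, Fin.sum_univ_two, Pi.add_apply, Pi.sub_apply,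
    Pi.smul_apply, smul_eq_mul, h]
  ring

/-- The mean squared error of one SPSA step with i.i.d. perturbations of law `μ`, where `μ` is
centred with unit variance and its inverse is centred with second moment `M`. -/
lemma integral_spsa_sq_error (Q : Matrix (Fin 2) (Fin 2) ℝ) (hQ : Q.IsSymm)
    (b θ₀ θs : Fin 2 → ℝ) (a c : ℝ) (hc : 0 < c) (L : (Fin 2 → ℝ) → ℝ)
    (hL : ∀ θ, L θ = (1 / 2) * (θ ⬝ᵥ Q.mulVec θ) + b ⬝ᵥ θ)
    (g : Fin 2 → ℝ) (hg : g = Q.mulVec θ₀ + b)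
    (νp νm : Measure ℝ) [IsProbabilityMeasure νp] [IsProbabilityMeasure νm] (s : ℝ)
    (hp1 : HasIntegralValue νp (fun x => x) 0) (hp2 : HasIntegralValue νp (fun x => x ^ 2) s)
    (hm1 : HasIntegralValue νm (fun x => x) 0) (hm2 : HasIntegralValue νm (fun x => x ^ 2) s)
    (μ : Measure ℝ) [IsProbabilityMeasure μ] (M : ℝ) (h0 : ∀ᵐ x ∂μ, x ≠ 0)
    (h1 : HasIntegralValue μ (fun x => x) 0) (h2 : HasIntegralValue μ (fun x => x ^ 2) 1)
    (h3 : HasIntegralValue μ (fun x => x⁻¹) 0) (h4 : HasIntegralValue μ (fun x => x⁻¹ ^ 2) M)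
    (θ1 : ((Fin 2 → ℝ) × ℝ × ℝ) → Fin 2 → ℝ)
    (hθ1 : ∀ ω i, θ1 ω i = θ₀ i -
      a / (2 * c) * (L (θ₀ + c • ω.1) - L (θ₀ - c • ω.1) + ω.2.1 - ω.2.2) * (ω.1 i)⁻¹) :
    ∫ ω, ∑ i, (θ1 ω i - θs i) ^ 2 ∂(Measure.pi fun _ : Fin 2 => μ).prod (νp.prod νm) =
      (θ₀ 0 - θs 0) ^ 2 + (θ₀ 1 - θs 1) ^ 2
        - 2 * a * (g 0 * (θ₀ 0 - θs 0) + g 1 * (θ₀ 1 - θs 1))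
        + a ^ 2 * ((1 + M) * (g 0 ^ 2 + g 1 ^ 2) + M * s / c ^ 2) := by
  obtain ⟨n1, n2⟩ := hasIntegralValue_noise_sub hp1 hp2 hm1 hm2
  have u := HasIntegralValue.one (μ := μ)
  have n0 := HasIntegralValue.one (μ := νp.prod νm)
  have hne : ∀ i : Fin 2, ∀ᵐ ω ∂(Measure.pi fun _ : Fin 2 => μ).prod (νp.prod νm), ω.1 i ≠ 0 :=
    fun i => Measure.quasiMeasurePreserving_fst.ae
      ((Measure.quasiMeasurePreserving_eval (fun _ : Fin 2 => μ) i).ae h0)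
  set d0 := θ₀ 0 - θs 0 with hd0
  set d1 := θ₀ 1 - θs 1 with hd1
  have const := (u.mul_pi_two u).mul_prod n0
  have t0 := (((h4.mul_pi_two h2).mul_prod n0).const_mul (a ^ 2 * g 1 ^ 2)).add
    ((((h4.mul_pi_two u).mul_prod n2).const_mul (a ^ 2 / (4 * c ^ 2))).add
    ((((h3.mul_pi_two h1).mul_prod n0).const_mul (-2 * (d0 - a * g 0) * a * g 1)).add
    ((((h3.mul_pi_two u).mul_prod n1).const_mul (-(d0 - a * g 0) * a / c)).add
    (((h4.mul_pi_two h1).mul_prod n1).const_mul (a ^ 2 * g 1 / c)))))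
  have t1 := (((h2.mul_pi_two h4).mul_prod n0).const_mul (a ^ 2 * g 0 ^ 2)).add
    ((((u.mul_pi_two h4).mul_prod n2).const_mul (a ^ 2 / (4 * c ^ 2))).add
    ((((h1.mul_pi_two h3).mul_prod n0).const_mul (-2 * (d1 - a * g 1) * a * g 0)).add
    ((((u.mul_pi_two h3).mul_prod n1).const_mul (-(d1 - a * g 1) * a / c)).add
    (((h1.mul_pi_two h4).mul_prod n1).const_mul (a ^ 2 * g 0 / c)))))
  have T := (const.const_mul ((d0 - a * g 0) ^ 2 + (d1 - a * g 1) ^ 2)).add (t0.add t1)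
  refine (T.congr_ae ?_).2.trans ?_
  · filter_upwards [hne 0, hne 1] with ω hx hy
    have e0 : θ₀ 0 = d0 + θs 0 := by simp [hd0]
    have e1 : θ₀ 1 = d1 + θs 1 := by simp [hd1]
    simp only [Fin.sum_univ_two, hθ1, quadratic_central_difference_s9 Q hQ b θ₀ L hL g hg]
    rw [e0, e1]
    field_simp
    ring
  · field_simp
    ring

lemma isProbabilityMeasure_bernoulliPM : IsProbabilityMeasure bernoulliPM := by
  constructor
  simp only [bernoulliPM, Measure.smul_apply, Measure.add_apply, measure_univ, smul_eq_mul]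
  rw [one_add_one_eq_two]
  exact ENNReal.inv_mul_cancel (by norm_num) (by norm_num)

lemma hasIntegralValue_bernoulliPM (f : ℝ → ℝ) :
    HasIntegralValue bernoulliPM f ((f (-1) + f 1) / 2) := by
  have i1 : Integrable f (Measure.dirac (-1)) := integrable_dirac (by simp)
  have i2 : Integrable f (Measure.dirac 1) := integrable_dirac (by simp)
  refine ⟨(i1.add_measure i2).smul_measure (by norm_num), ?_⟩
  rw [bernoulliPM, integral_smul_measure, integral_add_measure i1 i2, integral_dirac,
    integral_dirac]
  simp
  ring

lemma bernoulliPM_ae_ne_zero : ∀ᵐ x ∂bernoulliPM, x ≠ 0 := by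
  refine Measure.ae_smul_measure ?_ _
  rw [ae_add_measure_iff]
  constructor <;> rw [ae_dirac_eq] <;> simp

/-- The endpoints of the positive segment of `suSet`. -/
lemma suSet_endpoints : ∃ A B : ℝ, 0 < A ∧ A < B ∧ A + B = 19 / 10 ∧ A * B = 61 / 100 ∧
    suSet = Set.Ioo (-B) (-A) ∪ Set.Ioo A B := by
  have h : Real.sqrt 13 ^ 2 = 13 := Real.sq_sqrt (by norm_num)
  have hpos : 0 < Real.sqrt 13 := by positivity
  exact ⟨(19 - 3 * Real.sqrt 13) / 20, (19 + 3 * Real.sqrt 13) / 20, by nlinarith, by linarith,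
    by ring, by nlinarith, rfl⟩

lemma volume_symm_segments {A B : ℝ} (hA : 0 < A) (hAB : A < B) :
    volume (Set.Ioo (-B) (-A) ∪ Set.Ioo A B) = ENNReal.ofReal (2 * (B - A)) := by
  rw [measure_union ?_ measurableSet_Ioo, Real.volume_Ioo, Real.volume_Ioo,
    ← ENNReal.ofReal_add (by linarith) (by linarith)]
  · congr 1; ring
  · rw [Set.disjoint_left]
    rintro x ⟨_, h1⟩ ⟨h2, _⟩
    linarith

lemma isProbabilityMeasure_suMeasure : IsProbabilityMeasure suMeasure := by
  obtain ⟨A, B, hA, hAB, -, -, hS⟩ := suSet_endpoints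
  have hv : volume suSet = ENNReal.ofReal (2 * (B - A)) := hS ▸ volume_symm_segments hA hAB
  constructor
  simp only [suMeasure, Measure.smul_apply, Measure.restrict_apply_univ, smul_eq_mul]
  refine ENNReal.inv_mul_cancel ?_ ?_ <;> rw [hv]
  · simpa using hAB
  · exact ENNReal.ofReal_ne_top

lemma suMeasure_ae_ne_zero : ∀ᵐ x ∂suMeasure, x ≠ 0 := by
  refine Measure.ae_smul_measure (ae_restrict_of_ae ?_) _
  simp [ae_iff]

/-- Integration of a function continuous off `0` over two symmetric segments. -/
lemma hasIntegralValue_symm_segments {A B : ℝ} (hA : 0 < A) (hAB : A < B)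
    (f : ℝ → ℝ) (hf : ContinuousOn f {0}ᶜ) :
    HasIntegralValue (volume.restrict (Set.Ioo (-B) (-A) ∪ Set.Ioo A B)) f
      ((∫ x in A..B, f (-x)) + ∫ x in A..B, f x) := by
  have i1 : IntegrableOn f (Set.Ioo (-B) (-A)) := by
    refine ((hf.mono ?_).integrableOn_compact isCompact_Icc).mono_set Set.Ioo_subset_Icc_self
    rintro x ⟨_, h⟩ (rfl : x = 0)
    linarith
  have i2 : IntegrableOn f (Set.Ioo A B) := by
    refine ((hf.mono ?_).integrableOn_compact isCompact_Icc).mono_set Set.Ioo_subset_Icc_self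
    rintro x ⟨h, _⟩ (rfl : x = 0)
    linarith
  refine ⟨i1.union i2, ?_⟩
  rw [setIntegral_union ?_ measurableSet_Ioo i1 i2, intervalIntegral.integral_comp_neg,
    intervalIntegral.integral_of_le (by linarith), intervalIntegral.integral_of_le hAB.le,
    integral_Ioc_eq_integral_Ioo, integral_Ioc_eq_integral_Ioo]
  rw [Set.disjoint_left]
  rintro x ⟨_, h1⟩ ⟨h2, _⟩
  linarith

/-- Integration against `suMeasure` of a function continuous off `0`. -/
lemma suMeasure_hasIntegralValue {A B : ℝ} (hA : 0 < A) (hAB : A < B)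
    (hS : suSet = Set.Ioo (-B) (-A) ∪ Set.Ioo A B) (f : ℝ → ℝ) (hf : ContinuousOn f {0}ᶜ) :
    HasIntegralValue suMeasure f
      ((2 * (B - A))⁻¹ * ((∫ x in A..B, f (-x)) + ∫ x in A..B, f x)) := by
  have h := hasIntegralValue_symm_segments hA hAB f hf
  have hpos : 0 < 2 * (B - A) := by linarith
  rw [suMeasure, hS, volume_symm_segments hA hAB]
  refine ⟨h.1.smul_measure ?_, ?_⟩
  · simpa using hAB
  · rw [integral_smul_measure, h.2, ENNReal.toReal_inv, ENNReal.toReal_ofReal hpos.le,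
      smul_eq_mul]

lemma integral_inv_sq {A B : ℝ} (hA : 0 < A) (hAB : A < B) :
    ∫ x in A..B, x⁻¹ ^ 2 = A⁻¹ - B⁻¹ := by
  have hne : ∀ x ∈ Set.uIcc A B, x ≠ 0 := by
    intro x hx
    rw [Set.uIcc_of_le hAB.le] at hx
    exact (hA.trans_le hx.1).ne'
  have h : ∀ x ∈ Set.uIcc A B, HasDerivAt (fun x : ℝ => -x⁻¹) (x⁻¹ ^ 2) x := by
    intro x hx
    simpa using (hasDerivAt_inv (hne x hx)).fun_neg
  rw [intervalIntegral.integral_eq_sub_of_hasDerivAt h]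
  · ring
  · exact ((continuousOn_id.inv₀ hne).pow 2).intervalIntegrable

lemma suMeasure_moments :
    HasIntegralValue suMeasure (fun x => x) 0 ∧ HasIntegralValue suMeasure (fun x => x ^ 2) 1 ∧
      HasIntegralValue suMeasure (fun x => x⁻¹) 0 ∧
      HasIntegralValue suMeasure (fun x => x⁻¹ ^ 2) (100 / 61) := by
  obtain ⟨A, B, hA, hAB, hsum, hprod, hS⟩ := suSet_endpoints
  have key := suMeasure_hasIntegralValue hA hAB hS
  have hinv : ContinuousOn (fun x : ℝ => x⁻¹) {0}ᶜ := continuousOn_inv₀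
  have hd : B - A ≠ 0 := (sub_pos.2 hAB).ne'
  have hB : B ≠ 0 := (hA.trans hAB).ne'
  refine ⟨?_, ?_, ?_, ?_⟩
  · refine (key (fun x => x) continuousOn_id).congr_value ?_
    rw [intervalIntegral.integral_neg]
    ring
  · refine (key (fun x => x ^ 2) (continuousOn_id.pow 2)).congr_value ?_
    simp only [neg_sq, integral_pow]
    field_simp
    norm_num
    have : (A + B) ^ 2 - A * B = 3 := by rw [hsum, hprod]; norm_num
    linear_combination (2 * (B - A)) * this
  · refine (key (fun x => x⁻¹) hinv).congr_value ?_
    simp [inv_neg, intervalIntegral.integral_neg]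
  · refine (key (fun x => x⁻¹ ^ 2) (hinv.pow 2)).congr_value ?_
    simp only [inv_neg, neg_sq]
    rw [integral_inv_sq hA hAB]
    have hA0 := hA.ne'
    field_simp
    linear_combination (-200) * hprod

/-- Corollary A.3 (display (A.11)): for one-iteration SPSA on a quadratic loss in `ℝ²`, if
`((161/61)a_S² − 2a_B²)(L₁² + L₂²) + (a_S − a_B)(σ²(a_S+a_B)/c_B²
 − 2(L₁(θ₀₁−θ₁*) + L₂(θ₀₂−θ₂*))) − a_S²σ²(1/c_B² − 100/(61c_S²)) < 0`,
then the segmented uniform distribution gives strictly smaller MSE than Bernoulli ±1. -/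
theorem stmt_9
    (Q : Matrix (Fin 2) (Fin 2) ℝ) (hQ : Q.IsSymm) (b : Fin 2 → ℝ)
    (θ₀ θs : Fin 2 → ℝ)
    (aS cS aB cB : ℝ) (haS : 0 < aS) (hcS : 0 < cS) (haB : 0 < aB) (hcB : 0 < cB)
    (L : (Fin 2 → ℝ) → ℝ)
    (hL : ∀ θ, L θ = (1 / 2) * (θ ⬝ᵥ Q.mulVec θ) + b ⬝ᵥ θ)
    (g : Fin 2 → ℝ) (hg : g = Q.mulVec θ₀ + b)
    (νSp νSm νBp νBm : Measure ℝ)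
    [IsProbabilityMeasure νSp] [IsProbabilityMeasure νSm]
    [IsProbabilityMeasure νBp] [IsProbabilityMeasure νBm]
    (σ : ℝ)
    (hSp1 : Integrable (fun x => x) νSp) (hSp2 : Integrable (fun x => x ^ 2) νSp)
    (hSm1 : Integrable (fun x => x) νSm) (hSm2 : Integrable (fun x => x ^ 2) νSm)
    (hBp1 : Integrable (fun x => x) νBp) (hBp2 : Integrable (fun x => x ^ 2) νBp)
    (hBm1 : Integrable (fun x => x) νBm) (hBm2 : Integrable (fun x => x ^ 2) νBm)
    (hSpm : ∫ x, x ∂νSp = 0) (hSmm : ∫ x, x ∂νSm = 0)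
    (hBpm : ∫ x, x ∂νBp = 0) (hBmm : ∫ x, x ∂νBm = 0)
    (hSpv : ∫ x, x ^ 2 ∂νSp = σ ^ 2) (hSmv : ∫ x, x ^ 2 ∂νSm = σ ^ 2)
    (hBpv : ∫ x, x ^ 2 ∂νBp = σ ^ 2) (hBmv : ∫ x, x ^ 2 ∂νBm = σ ^ 2)
    (PS PB : Measure ((Fin 2 → ℝ) × ℝ × ℝ))
    (hPS : PS = (Measure.pi fun _ : Fin 2 => suMeasure).prod (νSp.prod νSm))
    (hPB : PB = (Measure.pi fun _ : Fin 2 => bernoulliPM).prod (νBp.prod νBm))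
    (θ1S θ1B : ((Fin 2 → ℝ) × ℝ × ℝ) → Fin 2 → ℝ)
    (hθ1S : ∀ ω i, θ1S ω i = θ₀ i -
      aS / (2 * cS) * (L (θ₀ + cS • ω.1) - L (θ₀ - cS • ω.1) + ω.2.1 - ω.2.2) * (ω.1 i)⁻¹)
    (hθ1B : ∀ ω i, θ1B ω i = θ₀ i -
      aB / (2 * cB) * (L (θ₀ + cB • ω.1) - L (θ₀ - cB • ω.1) + ω.2.1 - ω.2.2) * (ω.1 i)⁻¹)
    (hcond :
      (161 / 61 * aS ^ 2 - 2 * aB ^ 2) * (g 0 ^ 2 + g 1 ^ 2)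
        + (aS - aB) * (σ ^ 2 * (aS + aB) / cB ^ 2
            - 2 * (g 0 * (θ₀ 0 - θs 0) + g 1 * (θ₀ 1 - θs 1)))
        - aS ^ 2 * σ ^ 2 * (1 / cB ^ 2 - 100 / (61 * cS ^ 2)) < 0) :
    ∫ ω, ∑ i, (θ1S ω i - θs i) ^ 2 ∂PS < ∫ ω, ∑ i, (θ1B ω i - θs i) ^ 2 ∂PB := by
  have := isProbabilityMeasure_suMeasure
  have := isProbabilityMeasure_bernoulliPM
  obtain ⟨s1, s2, s3, s4⟩ := suMeasure_moments
  have b1 : HasIntegralValue bernoulliPM (fun x => x) 0 :=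
    (hasIntegralValue_bernoulliPM fun x => x).congr_value (by norm_num)
  have b2 : HasIntegralValue bernoulliPM (fun x => x ^ 2) 1 :=
    (hasIntegralValue_bernoulliPM fun x => x ^ 2).congr_value (by norm_num)
  have b3 : HasIntegralValue bernoulliPM (fun x => x⁻¹) 0 :=
    (hasIntegralValue_bernoulliPM fun x => x⁻¹).congr_value (by norm_num)
  have b4 : HasIntegralValue bernoulliPM (fun x => x⁻¹ ^ 2) 1 :=
    (hasIntegralValue_bernoulliPM fun x => x⁻¹ ^ 2).congr_value (by norm_num)
  rw [hPS, hPB,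
    integral_spsa_sq_error Q hQ b θ₀ θs aS cS hcS L hL g hg νSp νSm (σ ^ 2) ⟨hSp1, hSpm⟩
      ⟨hSp2, hSpv⟩ ⟨hSm1, hSmm⟩ ⟨hSm2, hSmv⟩ suMeasure (100 / 61) suMeasure_ae_ne_zero
      s1 s2 s3 s4 θ1S hθ1S,
    integral_spsa_sq_error Q hQ b θ₀ θs aB cB hcB L hL g hg νBp νBm (σ ^ 2) ⟨hBp1, hBpm⟩
      ⟨hBp2, hBpv⟩ ⟨hBm1, hBmm⟩ ⟨hBm2, hBmv⟩ bernoulliPM 1 bernoulliPM_ae_ne_zero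
      b1 b2 b3 b4 θ1B hθ1B, ← sub_neg]
  refine lt_of_eq_of_lt ?_ hcond
  field_simp
  ring
end

section
/- The segmented uniform distribution μ_S has the same first two moments as the Bernoulli ±1 distribution and its inverse second moment equals 100/61: ∫ x dμ_S(x) = 0, ∫ x² dμ_S(x) = 1, and ∫ x⁻² dμ_S(x) = 100/61. (The moment claims of Table A.1 and the matching of mean and variance with the Bernoulli ±1 distribution.) -/
open MeasureTheory Real

theorem integral_smul_restrict_symmetric_Ioo_union {a b : ℝ} (ha : 0 < a) (hab : a < b)
    {f : ℝ → ℝ} (hf : ContinuousOn f {0}ᶜ) :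
    ∫ x, f x ∂((volume (Set.Ioo (-b) (-a) ∪ Set.Ioo a b))⁻¹ •
      volume.restrict (Set.Ioo (-b) (-a) ∪ Set.Ioo a b)) =
      (2 * (b - a))⁻¹ * ((∫ x in a..b, f (-x)) + ∫ x in a..b, f x) := by
  have hd : Disjoint (Set.Ioo (-b) (-a)) (Set.Ioo a b) :=
    Set.disjoint_left.2 fun x hx hx' => by
      have h₁ := hx.2
      have h₂ := hx'.1
      linarith
  have hvol : volume (Set.Ioo (-b) (-a) ∪ Set.Ioo a b) = ENNReal.ofReal (2 * (b - a)) := by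
    rw [measure_union hd measurableSet_Ioo, Real.volume_Ioo, Real.volume_Ioo,
      ← ENNReal.ofReal_add (by linarith) (by linarith)]
    congr 1
    ring
  have hpos : IntegrableOn f (Set.Ioo a b) := by
    refine ((hf.mono fun x hx => ?_).integrableOn_Icc).mono_set Set.Ioo_subset_Icc_self
    exact (ha.trans_le hx.1).ne'
  have hneg : IntegrableOn f (Set.Ioo (-b) (-a)) := by
    refine ((hf.mono fun x hx => ?_).integrableOn_Icc).mono_set Set.Ioo_subset_Icc_self
    exact (hx.2.trans_lt (neg_lt_zero.2 ha)).ne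
  rw [integral_smul_measure, setIntegral_union hd measurableSet_Ioo hneg hpos, hvol,
    ENNReal.toReal_inv, ENNReal.toReal_ofReal (by linarith), smul_eq_mul,
    ← integral_Ioc_eq_integral_Ioo, ← integral_Ioc_eq_integral_Ioo,
    ← intervalIntegral.integral_of_le (by linarith), ← intervalIntegral.integral_of_le hab.le,
    intervalIntegral.integral_comp_neg]

theorem integral_inv_sq_of_pos {a b : ℝ} (ha : 0 < a) (hab : a < b) :
    ∫ x in a..b, (x ^ 2)⁻¹ = (b - a) / (a * b) := by
  have hne : ∀ x ∈ Set.uIcc a b, x ≠ 0 := fun x hx => by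
    rw [Set.uIcc_of_le hab.le] at hx
    exact (ha.trans_le hx.1).ne'
  have hderiv : ∀ x ∈ Set.uIcc a b, HasDerivAt (fun y : ℝ => -y⁻¹) (x ^ 2)⁻¹ x :=
    fun x hx => (hasDerivAt_inv (hne x hx)).neg.congr_deriv (neg_neg _)
  have hcont : ContinuousOn (fun x : ℝ => (x ^ 2)⁻¹) (Set.uIcc a b) :=
    (continuousOn_id.pow 2).inv₀ fun x hx => pow_ne_zero 2 (hne x hx)
  rw [intervalIntegral.integral_eq_sub_of_hasDerivAt hderiv hcont.intervalIntegrable]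
  have hb : b ≠ 0 := (ha.trans hab).ne'
  field_simp
  ring

theorem integral_bernoulliPM (f : ℝ → ℝ) :
    ∫ x, f x ∂bernoulliPM = 2⁻¹ * (f (-1) + f 1) := by
  rw [bernoulliPM, integral_smul_measure,
    integral_add_measure (integrable_dirac (by simp)) (integrable_dirac (by simp)),
    integral_dirac, integral_dirac]
  simp

/-- Table A.1: the segmented uniform distribution has the same first two moments as the
Bernoulli ±1 distribution, namely mean `0` and second moment `1`, and its inverse second
moment equals `100/61`. -/
theorem stmt_10 :
    (∫ x, x ∂suMeasure = ∫ x, x ∂bernoulliPM) ∧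
    (∫ x, x ^ 2 ∂suMeasure = ∫ x, x ^ 2 ∂bernoulliPM) ∧
    (∫ x, x ∂suMeasure = 0) ∧
    (∫ x, x ^ 2 ∂suMeasure = 1) ∧
    (∫ x, (x ^ 2)⁻¹ ∂suMeasure = 100 / 61) := by
  have hs : √13 ^ 2 = 13 := Real.sq_sqrt (by norm_num)
  have hs₀ : 0 < √13 := by positivity
  have ha : 0 < (19 - 3 * √13) / 20 := by nlinarith
  have hab : (19 - 3 * √13) / 20 < (19 + 3 * √13) / 20 := by linarith
  have hmean : ∫ x, x ∂suMeasure = 0 := by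
    rw [suMeasure, suSet, integral_smul_restrict_symmetric_Ioo_union ha hab
      (f := fun x => x) continuousOn_id]
    rw [intervalIntegral.integral_neg, neg_add_cancel, mul_zero]
  have hsecond : ∫ x, x ^ 2 ∂suMeasure = 1 := by
    rw [suMeasure, suSet, integral_smul_restrict_symmetric_Ioo_union ha hab
      (f := fun x => x ^ 2) (continuous_pow 2).continuousOn]
    simp only [neg_sq, integral_pow]
    field_simp
    ring_nf
    simp only [show √13 ^ 3 = √13 ^ 2 * √13 by ring, hs]
    field_simp
    norm_num
  have hinv : ∫ x, (x ^ 2)⁻¹ ∂suMeasure = 100 / 61 := by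
    rw [suMeasure, suSet, integral_smul_restrict_symmetric_Ioo_union ha hab
      (f := fun x => (x ^ 2)⁻¹) ((continuousOn_id.pow 2).inv₀ fun x hx => pow_ne_zero 2 hx)]
    have hprod : (19 - 3 * √13) / 20 * ((19 + 3 * √13) / 20) = 61 / 100 := by
      linear_combination (-9 / 400) * hs
    simp only [neg_sq]
    rw [integral_inv_sq_of_pos ha hab, hprod]
    field_simp
    ring
  refine ⟨?_, ?_, hmean, hsecond, hinv⟩
  · rw [hmean, integral_bernoulliPM]
    norm_num
  · rw [hsecond, integral_bernoulliPM]
    norm_num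
end

section
/- Let H be a symmetric p×p real matrix, b ∈ ℝ^p, and g(θ) = Hθ + b (the gradient of a quadratic function with Hessian H). Fix θ ∈ ℝ^p, c > 0, and δ ∈ ℝ^p with δᵢ ≠ 0 for every i, and let δ⁻¹ = (1/δ₁, …, 1/δ_p). Then the simultaneous perturbation Hessian estimate Ĥ = (1/2)·[ ((g(θ + cδ) − g(θ − cδ))/(2c))·(δ⁻¹)ᵀ + ( ((g(θ + cδ) − g(θ − cδ))/(2c))·(δ⁻¹)ᵀ )ᵀ ] satisfies exactly Ĥ = H + Ψ(H), where D = δ·(δ⁻¹)ᵀ − I_p and Ψ(H) = (1/2)(H·D + Dᵀ·H). (The exact form of the decomposition (B.4) when the gradient is linear, so the O(c²) term vanishes.) -/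
open Matrix

/-- Exact decomposition of the simultaneous perturbation Hessian estimate when the gradient
is linear, `g(θ) = Hθ + b` with `H` symmetric: `Ĥ = H + Ψ(H)` where
`D = δ(δ⁻¹)ᵀ − I` and `Ψ(H) = (1/2)(H·D + Dᵀ·H)`. -/
theorem stmt_13 (p : ℕ)
    (H : Matrix (Fin p) (Fin p) ℝ) (hH : H.IsSymm)
    (b : Fin p → ℝ) (g : (Fin p → ℝ) → Fin p → ℝ)
    (hg : ∀ θ, g θ = H.mulVec θ + b)
    (θ : Fin p → ℝ) (c : ℝ) (hc : 0 < c)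
    (δ : Fin p → ℝ) (hδ : ∀ i, δ i ≠ 0)
    (δinv : Fin p → ℝ) (hδinv : ∀ i, δinv i = (δ i)⁻¹)
    (Hhat D Ψ : Matrix (Fin p) (Fin p) ℝ)
    (hHhat : Hhat = (1 / 2 : ℝ) •
      (Matrix.vecMulVec ((2 * c)⁻¹ • (g (θ + c • δ) - g (θ - c • δ))) δinv +
        (Matrix.vecMulVec ((2 * c)⁻¹ • (g (θ + c • δ) - g (θ - c • δ))) δinv)ᵀ))
    (hD : D = Matrix.vecMulVec δ δinv - 1)
    (hΨ : Ψ = (1 / 2 : ℝ) • (H * D + Dᵀ * H)) :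
    Hhat = H + Ψ := by
  have hquot : (2 * c)⁻¹ • (g (θ + c • δ) - g (θ - c • δ)) = H *ᵥ δ := by
    have hdiff : g (θ + c • δ) - g (θ - c • δ) = (2 * c) • H *ᵥ δ := by
      rw [hg, hg, mulVec_add, mulVec_sub, mulVec_smul]
      module
    rw [hdiff, inv_smul_smul₀ (by positivity)]
  rw [hHhat, hΨ, hD, hquot, ← mul_vecMulVec, transpose_mul, hH.eq, transpose_sub,
    transpose_one, mul_sub, sub_mul, mul_one, one_mul]
  module
end
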